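/- arXiv:1709.01982 — 3 statements merged into one kernel-verified Lean document; each statement's English description precedes it below -/
import Mathlib

section
/- Let C∪M be a connector with terminal sets S_1,…,S_k. Then for every index i ∈ {1,…,k} there exists an M-alternating path contained in C∪M that starts at a vertex of S_i, ends at a vertex of S_j for some j ≠ i, and whose two endpoints are M-exposed (i.e., the path starts and ends with edges not in M). -/
namespace Stabilizer

variable {V : Type*} [Fintype V] [DecidableEq V]

/-- The set of vertices covered by a finite set of edges. -/
def edgeVerts (C : Finset (Sym2 V)) : Set V := {v | ∃ e ∈ C, v ∈ e}

/-- A matching of `G`, given as a finite set of pairwise vertex-disjoint edges. -/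
def IsMatching (G : SimpleGraph V) (M : Finset (Sym2 V)) : Prop :=
  (↑M ⊆ G.edgeSet) ∧ ∀ e ∈ M, ∀ f ∈ M, e ≠ f → ∀ v : V, v ∈ e → v ∉ f

/-- The total weight of a finite set of edges. -/
noncomputable def setWeight (w : Sym2 V → ℝ) (M : Finset (Sym2 V)) : ℝ := ∑ e ∈ M, w e

/-- ν(G): the maximum weight of a matching of `G`. -/
noncomputable def nu (G : SimpleGraph V) (w : Sym2 V → ℝ) : ℝ :=
  sSup {r : ℝ | ∃ M : Finset (Sym2 V), IsMatching G M ∧ r = setWeight w M}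

/-- A fractional matching of `G`. -/
def IsFracMatching (G : SimpleGraph V) (x : Sym2 V → ℝ) : Prop :=
  (∀ e, 0 ≤ x e) ∧ (∀ e, e ∉ G.edgeSet → x e = 0) ∧ ∀ v : V, ∑ u : V, x s(v, u) ≤ 1

/-- The weight of a fractional matching. -/
noncomputable def fracWeight (w x : Sym2 V → ℝ) : ℝ := ∑ e : Sym2 V, w e * x e

/-- ν_f(G): the maximum weight of a fractional matching of `G`. -/
noncomputable def nuf (G : SimpleGraph V) (w : Sym2 V → ℝ) : ℝ :=
  sSup {r : ℝ | ∃ x : Sym2 V → ℝ, IsFracMatching G x ∧ r = fracWeight w x}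

/-- A maximum-weight fractional matching of `G`. -/
def IsMaxFracMatching (G : SimpleGraph V) (w x : Sym2 V → ℝ) : Prop :=
  IsFracMatching G x ∧ ∀ y : Sym2 V → ℝ, IsFracMatching G y → fracWeight w y ≤ fracWeight w x

/-- All entries lie in {0, 1/2, 1}. -/
def IsHalfIntegral (x : Sym2 V → ℝ) : Prop := ∀ e, x e = 0 ∨ x e = 1 / 2 ∨ x e = 1

/-- `C` is the edge set of an odd cycle of `G`. -/
def IsOddCycleEdgeSet (G : SimpleGraph V) (C : Finset (Sym2 V)) : Prop :=
  ∃ (v : V) (c : G.Walk v v), c.IsCycle ∧ Odd c.length ∧ c.edges.toFinset = C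

/-- `F` is the family 𝒞(x) of vertex-disjoint odd cycles carrying exactly the
half-valued edges of `x`. -/
def IsCycleFamily (G : SimpleGraph V) (x : Sym2 V → ℝ) (F : Finset (Finset (Sym2 V))) : Prop :=
  (∀ C ∈ F, IsOddCycleEdgeSet G C) ∧
  (∀ C ∈ F, ∀ D ∈ F, C ≠ D → Disjoint (edgeVerts C) (edgeVerts D)) ∧
  (∀ e : Sym2 V, x e = 1 / 2 ↔ ∃ C ∈ F, e ∈ C)

/-- A basic fractional matching of `G`. -/
def IsBasic (G : SimpleGraph V) (x : Sym2 V → ℝ) : Prop :=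
  IsFracMatching G x ∧ IsHalfIntegral x ∧ ∃ F, IsCycleFamily G x F

/-- γ(G): the minimum number of odd cycles in the support of a basic
maximum-weight fractional matching of `G`. -/
noncomputable def gamma (G : SimpleGraph V) (w : Sym2 V → ℝ) : ℕ :=
  sInf {n : ℕ | ∃ (x : Sym2 V → ℝ) (F : Finset (Finset (Sym2 V))),
    IsMaxFracMatching G w x ∧ IsHalfIntegral x ∧ IsCycleFamily G x F ∧ F.card = n}

/-- `G` is stable: ν(G) = ν_f(G). -/
def IsStable (G : SimpleGraph V) (w : Sym2 V → ℝ) : Prop := nu G w = nuf G w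

/-- Deletion of a set of vertices (as the spanning subgraph obtained by
removing all edges incident to `S`; matchings, fractional matchings and covers
of `G∖S` correspond to those of this graph). -/
def deleteVerts (G : SimpleGraph V) (S : Set V) : SimpleGraph V where
  Adj a b := G.Adj a b ∧ a ∉ S ∧ b ∉ S
  symm := ⟨fun _ _ h => ⟨h.1.symm, h.2.2, h.2.1⟩⟩
  loopless := ⟨fun a h => G.loopless.irrefl a h.1⟩

/-- A fractional w-vertex cover of `G`. -/
def IsFracCover (G : SimpleGraph V) (w : Sym2 V → ℝ) (y : V → ℝ) : Prop :=
  (∀ v, 0 ≤ y v) ∧ ∀ a b : V, G.Adj a b → w s(a, b) ≤ y a + y b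

noncomputable def coverValue (y : V → ℝ) : ℝ := ∑ v : V, y v

/-- A minimum fractional w-vertex cover of `G`. -/
def IsMinFracCover (G : SimpleGraph V) (w : Sym2 V → ℝ) (y : V → ℝ) : Prop :=
  IsFracCover G w y ∧ ∀ z : V → ℝ, IsFracCover G w z → coverValue y ≤ coverValue z

/-- M(x): the 1-valued edges of `x`. -/
noncomputable def oneEdges (x : Sym2 V → ℝ) : Finset (Sym2 V) :=
  Finset.univ.filter fun e => x e = 1

/-- `v` is exposed by the matching `M`. -/
def MExposed (M : Finset (Sym2 V)) (v : V) : Prop := ∀ e ∈ M, v ∉ e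

/-- A list of edges alternately in and out of `M`. -/
def AltList (M : Finset (Sym2 V)) (l : List (Sym2 V)) : Prop :=
  l.Chain' fun e f => (e ∈ M ↔ f ∉ M)

variable {G : SimpleGraph V}

/-- An M-alternating walk. -/
def IsAltWalk (M : Finset (Sym2 V)) {a b : V} (p : G.Walk a b) : Prop := AltList M p.edges

/-- A valid walk: it starts (resp. ends) with an M-exposed vertex or an edge of `M`. -/
def IsValidWalk (M : Finset (Sym2 V)) {a b : V} (p : G.Walk a b) : Prop :=
  (MExposed M a ∨ ∃ e ∈ M, p.edges.head? = some e) ∧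
  (MExposed M b ∨ ∃ e ∈ M, p.edges.getLast? = some e)

/-- w(P ∩ M), with multiplicity. -/
noncomputable def wIn (w : Sym2 V → ℝ) (M : Finset (Sym2 V)) (l : List (Sym2 V)) : ℝ :=
  (l.map fun e => if e ∈ M then w e else 0).sum

/-- w(P ∖ M), with multiplicity. -/
noncomputable def wOut (w : Sym2 V → ℝ) (M : Finset (Sym2 V)) (l : List (Sym2 V)) : ℝ :=
  (l.map fun e => if e ∈ M then 0 else w e).sum

/-- An M-augmenting walk. -/
def IsAugWalk (w : Sym2 V → ℝ) (M : Finset (Sym2 V)) {a b : V} (p : G.Walk a b) : Prop :=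
  IsAltWalk M p ∧ IsValidWalk M p ∧ wIn w M p.edges < wOut w M p.edges

/-- An M-augmenting path. -/
def IsAugPath (w : Sym2 V → ℝ) (M : Finset (Sym2 V)) {a b : V} (p : G.Walk a b) : Prop :=
  p.IsPath ∧ IsAugWalk w M p

/-- An M-alternating cycle (an even cycle alternately in and out of `M`). -/
def IsAltCycle (M : Finset (Sym2 V)) {a : V} (c : G.Walk a a) : Prop :=
  c.IsCycle ∧ Even c.length ∧ AltList M c.edges ∧
  ∀ e f : Sym2 V, c.edges.head? = some e → c.edges.getLast? = some f → (e ∈ M ↔ f ∉ M)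

/-- An M-augmenting cycle. -/
def IsAugCycle (w : Sym2 V → ℝ) (M : Finset (Sym2 V)) {a : V} (c : G.Walk a a) : Prop :=
  IsAltCycle M c ∧ wIn w M c.edges < wOut w M c.edges

/-- An M-blossom with base `a` (traversed starting and ending at its base). -/
def IsBlossom (M : Finset (Sym2 V)) {a : V} (c : G.Walk a a) : Prop :=
  c.IsCycle ∧ Odd c.length ∧ AltList M c.edges ∧
  ∀ e : Sym2 V, c.edges.head? = some e → e ∉ M

/-- An M-flower: an M-blossom `c` with base `a` together with a valid M-alternating
path `p` from the base `a` to the root `r`, starting with an edge of `M`. -/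
def IsFlower (M : Finset (Sym2 V)) {a r : V} (c : G.Walk a a) (p : G.Walk a r) : Prop :=
  IsBlossom M c ∧ p.IsPath ∧ AltList M p.edges ∧
  (∃ e ∈ M, p.edges.head? = some e) ∧
  (MExposed M r ∨ ∃ e ∈ M, p.edges.getLast? = some e)

/-- An M-augmenting flower (with root `r`). -/
def IsAugFlower (w : Sym2 V → ℝ) (M : Finset (Sym2 V)) {a r : V}
    (c : G.Walk a a) (p : G.Walk a r) : Prop :=
  IsFlower M c p ∧
  wIn w M c.edges + 2 * wIn w M p.edges < wOut w M c.edges + 2 * wOut w M p.edges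

/-- An M-bi-cycle: two M-blossoms `c`, `d` with bases `a`, `b` joined by an odd
M-alternating path `p` starting and ending with edges of `M`. -/
def IsBicycle (M : Finset (Sym2 V)) {a b : V}
    (c : G.Walk a a) (p : G.Walk a b) (d : G.Walk b b) : Prop :=
  IsBlossom M c ∧ IsBlossom M d ∧ p.IsPath ∧ Odd p.length ∧ AltList M p.edges ∧
  (∃ e ∈ M, p.edges.head? = some e) ∧ (∃ e ∈ M, p.edges.getLast? = some e)

/-- An M-augmenting bi-cycle. -/
def IsAugBicycle (w : Sym2 V → ℝ) (M : Finset (Sym2 V)) {a b : V}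
    (c : G.Walk a a) (p : G.Walk a b) (d : G.Walk b b) : Prop :=
  IsBicycle M c p d ∧
  wIn w M c.edges + 2 * wIn w M p.edges + wIn w M d.edges <
    wOut w M c.edges + 2 * wOut w M p.edges + wOut w M d.edges

/-- All edges of the walk are tight with respect to the fractional vertex cover `y`. -/
def IsTightWalk (w : Sym2 V → ℝ) (y : V → ℝ) {a b : V} (p : G.Walk a b) : Prop :=
  ∀ d ∈ p.darts, y d.toProd.1 + y d.toProd.2 = w s(d.toProd.1, d.toProd.2)

/-- `x'` is the result of alternate rounding on the odd cycle with edge set `C`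
at the vertex `u`: on `C` it is 0/1-valued, both edges of `C` at `u` get value 0,
and its 1-valued edges inside `C` perfectly match the remaining vertices of `C`. -/
def AltRoundedOn (x' : Sym2 V → ℝ) (C : Finset (Sym2 V)) (u : V) : Prop :=
  (∀ e ∈ C, x' e = 0 ∨ x' e = 1) ∧ (∀ e ∈ C, u ∈ e → x' e = 0) ∧
  ∀ z ∈ edgeVerts C, z ≠ u → ∃! e : Sym2 V, e ∈ C ∧ x' e = 1 ∧ z ∈ e


/-- A finite set of odd cardinality is not closed under a fixed-point-free involution. -/
lemma exists_notMem_of_odd_ncard {α : Type*} [Finite α] {m : α → α}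
    (hm : Function.Involutive m) (hfix : ∀ x, m x ≠ x) {s : Set α} (hs : Odd s.ncard) :
    ∃ x ∈ s, m x ∉ s := by
  classical
  by_contra! h
  have := Fintype.ofFinite α
  have h0 : ∑ x ∈ s.toFinset, (1 : ZMod 2) = 0 := by
    refine Finset.sum_involution (fun x _ => m x) (fun _ _ => by decide)
      (fun x _ _ => hfix x) (fun x hx => ?_) (fun x _ => hm x)
    simpa using h x (by simpa using hx)
  rw [Finset.sum_const, nsmul_one, ← Set.ncard_eq_toFinset_card', ZMod.natCast_eq_zero_iff] at h0
  exact (Nat.not_even_iff_odd.2 hs) (even_iff_two_dvd.2 h0)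

/-- A spanning cycle yields a cyclic successor function on the vertices. -/
lemma exists_cyclic_succ {V : Type*} {G : SimpleGraph V} {v₀ : V} {c : G.Walk v₀ v₀}
    (hc : c.IsCycle) (hspan : ∀ x : V, x ∈ c.support) :
    ∃ f : V → V, Function.Injective f ∧ (∀ x, G.Adj x (f x)) ∧
      ∀ X : Set V, X.Nonempty → (∀ x ∈ X, f x ∈ X) → X = Set.univ := by
  have hlen := hc.three_le_length
  have hidx : ∀ x : V, ∃ i < c.length, c.getVert i = x := by
    intro x
    obtain ⟨i, hi, hle⟩ := SimpleGraph.Walk.mem_support_iff_exists_getVert.1 (hspan x)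
    rcases hle.lt_or_eq with h | h
    · exact ⟨i, h, hi⟩
    · refine ⟨0, by omega, ?_⟩
      rw [← hi, h, SimpleGraph.Walk.getVert_zero, SimpleGraph.Walk.getVert_length]
  choose idx hlt hidx using hidx
  have hsucc : ∀ i < c.length, c.getVert (idx (c.getVert i) + 1) = c.getVert (i + 1) := by
    intro i hi
    have : idx (c.getVert i) = i := by
      refine hc.getVert_injOn' ?_ ?_ (hidx _)
      · have := hlt (c.getVert i)
        simp only [Set.mem_ofPred_eq]
        omega
      · simp only [Set.mem_ofPred_eq]
        omega
    rw [this]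
  refine ⟨fun x => c.getVert (idx x + 1), ?_, ?_, ?_⟩
  · intro x y hxy
    have hx := hlt x
    have hy := hlt y
    have h : idx x + 1 = idx y + 1 := by
      refine hc.getVert_injOn ?_ ?_ hxy <;> simp only [Set.mem_ofPred_eq] <;> omega
    rw [← hidx x, ← hidx y, Nat.succ_injective h]
  · intro x
    have h := c.adj_getVert_succ (hlt x)
    rwa [hidx x] at h
  · rintro X ⟨x, hx⟩ hX
    have step : ∀ i < c.length, c.getVert i ∈ X → c.getVert (i + 1) ∈ X := by
      intro i hi h
      rw [← hsucc i hi]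
      exact hX _ h
    have up : ∀ i j, i ≤ j → j ≤ c.length → c.getVert i ∈ X → c.getVert j ∈ X := by
      intro i j hij
      induction j, hij using Nat.le_induction with
      | base => exact fun _ h => h
      | succ j _ ih => exact fun hj h => step j (by omega) (ih (by omega) h)
    have hzero : c.getVert 0 ∈ X := by
      have h := up (idx x) c.length (hlt x).le le_rfl (by rwa [hidx x])
      rwa [SimpleGraph.Walk.getVert_length, ← c.getVert_zero] at h
    refine Set.eq_univ_of_forall fun y => ?_
    rw [← hidx y]
    exact up 0 _ (Nat.zero_le _) (hlt y).le hzero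

/-- Let `H` be the image under `π` of a graph with a spanning cyclic successor function `f`, where
`π` identifies vertices only over `a` and `b`. If `H` has a perfect matching after the edge `ab` is
added, then `H` has a perfect matching. -/
lemma exists_isPerfectMatching_of_cyclic_succ {V W : Type*} [Finite W]
    (H : SimpleGraph W) {f : V → V} (hinj : Function.Injective f)
    (hcyc : ∀ X : Set V, X.Nonempty → (∀ x ∈ X, f x ∈ X) → X = Set.univ)
    {π : V → W} (hsurj : Function.Surjective π) {a b : W}
    (hπ : ∀ x y, π x = π y → π x ≠ a → π x ≠ b → x = y)
    (hadj : ∀ x, π x ≠ π (f x) → H.Adj (π x) (π (f x)))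
    {m : W → W} (hm : Function.Involutive m) (hfix : ∀ x, m x ≠ x) (hab : m a = b)
    (hmadj : ∀ x, x ≠ a → x ≠ b → H.Adj x (m x)) :
    ∃ N : H.Subgraph, N.IsPerfectMatching := by
  classical
  have := Fintype.ofFinite W
  have : Nonempty W := ⟨a⟩
  have : Nonempty V := ⟨(hsurj a).choose⟩
  rw [SimpleGraph.tutte]
  intro U hU
  set D := ((⊤ : H.Subgraph).deleteVerts U).coe with hD
  have hmem : ∀ x, x ∉ U → x ∈ ((⊤ : H.Subgraph).deleteVerts U).verts := by
    intro x hx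
    simpa using hx
  let comp : D.ConnectedComponent → Set W := fun K => (fun x => x.1) '' K.supp
  have hdisj : ∀ K L x, x ∈ comp K → x ∈ comp L → K = L := by
    rintro K L _ ⟨x, hx, rfl⟩ ⟨y, hy, hxy⟩
    obtain rfl : y = x := Subtype.ext hxy
    exact hx.symm.trans hy
  have hcl : ∀ K x y, x ∈ comp K → y ∉ U → H.Adj x y → y ∈ comp K := by
    rintro K _ y ⟨x, hx, rfl⟩ hy hxy
    refine ⟨⟨y, hmem y hy⟩, ?_, rfl⟩
    refine SimpleGraph.ConnectedComponent.mem_supp_of_adj_mem_supp K hx ?_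
    have hx' := x.2
    simp only [SimpleGraph.Subgraph.deleteVerts_verts, SimpleGraph.Subgraph.verts_top] at hx'
    simp [hD, hxy, hy, hx'.2]
  have hoff : ∀ K x, x ∈ comp K → x ∉ U := by
    rintro K _ ⟨x, hx, rfl⟩
    have hx' := x.2
    simp only [SimpleGraph.Subgraph.deleteVerts_verts, SimpleGraph.Subgraph.verts_top] at hx'
    exact hx'.2
  have hexit : ∀ K ∈ D.oddComponents, ∃ x ∈ comp K, m x ∉ comp K := by
    intro K hK
    refine exists_notMem_of_odd_ncard hm hfix ?_
    rw [Set.ncard_image_of_injective _ Subtype.val_injective]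
    exact hK
  have key : ∃ g : D.ConnectedComponent → W,
      (∀ K ∈ D.oddComponents, g K ∈ U) ∧ Set.InjOn g D.oddComponents := by
    by_cases hc : a ∉ U ∧ b ∉ U
    · have hout : ∀ K ∈ D.oddComponents, ∃ x, π x ∈ comp K ∧ π (f x) ∈ U := by
        intro K hK
        obtain ⟨y, hy, hmy⟩ := hexit K hK
        obtain ⟨y, rfl⟩ := hsurj y
        obtain ⟨z, hz⟩ := hsurj (m (π y))
        by_contra! h
        have huniv := hcyc {x | π x ∈ comp K} ⟨y, hy⟩ fun x hx => by
          by_cases hxf : π x = π (f x)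
          · exact (congrArg (· ∈ comp K) hxf).mp hx
          · exact hcl K _ _ hx (h x hx) (hadj x hxf)
        have : z ∈ {x | π x ∈ comp K} := huniv ▸ Set.mem_univ z
        exact hmy (hz ▸ this)
      choose! x hxK hxU using hout
      refine ⟨fun K => π (f (x K)), hxU, ?_⟩
      intro K hK L hL hKL
      have hfx := hπ _ _ hKL (fun h => hc.1 (h ▸ hxU K hK)) (fun h => hc.2 (h ▸ hxU K hK))
      have hx := hinj hfx
      exact hdisj K L (π (x K)) (hxK K hK) (hx ▸ hxK L hL)
    · have hout : ∀ K ∈ D.oddComponents, ∃ u ∈ U, m u ∈ comp K := by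
        intro K hK
        obtain ⟨y, hy, hmy⟩ := hexit K hK
        refine ⟨m y, ?_, by rwa [hm y]⟩
        by_contra hmU
        have hyU := hoff K y hy
        by_cases hya : y = a
        · subst hya
          exact hc ⟨hyU, hab ▸ hmU⟩
        by_cases hyb : y = b
        · subst hyb
          rw [← hab, hm a] at hmU
          exact hc ⟨hmU, hyU⟩
        exact hmy (hcl K y _ hy hmU (hmadj y hya hyb))
      choose! g hgU hgK using hout
      exact ⟨g, hgU, fun K hK L hL hKL => hdisj K L _ (hgK K hK) (hKL ▸ hgK L hL)⟩
  obtain ⟨g, hg, hginj⟩ := key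
  exact (Set.ncard_le_ncard_of_injOn g hg hginj U.toFinite).not_gt hU

/-- If `m` and `n` are the images of `M` and of a perfect matching, respectively, under a map `π`
that identifies vertices only over `A` and `B`, then following them alternately lifts to an
alternating path. -/
lemma exists_alternating_path_of_involutions {V W : Type*} [DecidableEq W]
    {G : SimpleGraph V} {M : Finset (Sym2 V)} {π : V → W} {A B : W}
    (hπ : ∀ x y, π x = π y → π x ≠ A → π x ≠ B → x = y)
    (hMG : ∀ u v, s(u, v) ∈ M → G.Adj u v)
    {m n : W → W} (hm : Function.Involutive m) (hmfix : ∀ x, m x ≠ x)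
    (hMm : ∀ u v, s(u, v) ∈ M → π u ≠ A ∧ π u ≠ B ∧ m (π u) = π v)
    (hmM : ∀ x, x ≠ A → x ≠ B → ∃ u v, π u = x ∧ π v = m x ∧ s(u, v) ∈ M)
    (hn : Function.Involutive n) (hnfix : ∀ x, n x ≠ x)
    (hnG : ∀ x, ∃ u v, π u = x ∧ π v = n x ∧ G.Adj u v)
    (X : Finset W) (a : W) (ha : a ∈ X) (haB : a ≠ B) (hB : B ∈ X) (hA : A ∉ X.erase a)
    (hnX : ∀ x ∈ X, n x ∈ X) (hmX : ∀ x ∈ X, x ≠ a → x ≠ B → m x ∈ X ∧ m x ≠ a) :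
    ∃ (u w : V) (p : G.Walk u w), π u = a ∧ π w = B ∧ p.IsPath ∧ (∀ x ∈ p.support, π x ∈ X) ∧
      AltList M p.edges ∧ ∀ e ∈ p.edges.head?, e ∉ M := by
  induction X using Finset.strongInduction generalizing a with
  | H X ih =>
  obtain ⟨u, v, rfl, hv, huv⟩ := hnG a
  have hvX : π v ∈ X := hv ▸ hnX _ ha
  have hvu : π v ≠ π u := hv ▸ hnfix _
  have huvM : s(u, v) ∉ M := by
    intro h
    rw [Sym2.eq_swap] at h
    obtain ⟨-, h2, h3⟩ := hMm v u h
    exact (hmX _ hvX hvu h2).2 h3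
  by_cases hvB : π v = B
  · refine ⟨u, v, .cons huv .nil, rfl, hvB, ?_, ?_, ?_, ?_⟩
    · simp [huv.ne]
    · simp [ha, hvX]
    · exact List.isChain_singleton _
    · simp [huvM]
  have hvA : π v ≠ A := fun h => hA (Finset.mem_erase.2 ⟨h ▸ hvu, h ▸ hvX⟩)
  obtain ⟨v', w, hv', hw, hvw⟩ := hmM (π v) hvA hvB
  obtain rfl := hπ v' v hv' (hv' ▸ hvA) (hv' ▸ hvB)
  obtain ⟨hwA, hwB, hmw⟩ := hMm w v' (by rwa [Sym2.eq_swap])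
  obtain ⟨hwX, hwu⟩ := hmX _ hvX hvu hvB
  rw [← hw] at hwX hwu
  have hwv : π w ≠ π v' := hw ▸ hmfix _
  have hX' : ∀ x, x ∈ (X.erase (π u)).erase (π v') ↔ x ≠ π v' ∧ x ≠ π u ∧ x ∈ X := by
    simp
  obtain ⟨w', z, p, hw', hz, hp, hpX, halt, hhead⟩ := ih ((X.erase (π u)).erase (π v'))
    ((Finset.erase_subset _ _).trans_ssubset (Finset.erase_ssubset ha)) (π w)
    ((hX' _).2 ⟨hwv, hwu, hwX⟩) hwB ((hX' _).2 ⟨Ne.symm hvB, Ne.symm haB, hB⟩)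
    (fun h => by
      have h := (hX' _).1 (Finset.mem_of_mem_erase h)
      exact hA (Finset.mem_erase.2 h.2))
    (fun x hx => by
      obtain ⟨h1, h2, h3⟩ := (hX' x).1 hx
      refine (hX' _).2 ⟨fun h => h2 ?_, fun h => h1 ?_, hnX x h3⟩
      · exact hn.injective (h.trans hv)
      · rw [hv, ← h, hn x])
    (fun x hx hxw hxB => by
      obtain ⟨h1, h2, h3⟩ := (hX' x).1 hx
      obtain ⟨h4, h5⟩ := hmX x h3 h2 hxB
      refine ⟨(hX' _).2 ⟨fun h => hxw ?_, h5, h4⟩, fun h => h1 ?_⟩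
      · rw [hw, ← h, hm x]
      · exact hm.injective (h.trans hw))
  obtain rfl := hπ w' w hw' (hw' ▸ hwA) (hw' ▸ hwB)
  have hvp : v' ∉ p.support := fun h => ((hX' _).1 (hpX _ h)).1 rfl
  have hup : u ∉ p.support := fun h => ((hX' _).1 (hpX _ h)).2.1 rfl
  refine ⟨u, z, .cons huv (.cons (hMG _ _ hvw) p), rfl, hz, ?_, ?_, ?_, ?_⟩
  · rw [SimpleGraph.Walk.cons_isPath_iff, SimpleGraph.Walk.cons_isPath_iff]
    refine ⟨⟨hp, hvp⟩, ?_⟩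
    simp [huv.ne, hup]
  · intro x hx
    simp only [SimpleGraph.Walk.support_cons, List.mem_cons] at hx
    rcases hx with rfl | rfl | hx
    · exact ha
    · exact hvX
    · exact ((hX' _).1 (hpX _ hx)).2.2
  · refine List.isChain_cons.2 ⟨?_,
      List.isChain_cons.2 ⟨fun e he => by simp [hvw, hhead e he], halt⟩⟩
    simp [huvM, hvw]
  · simp [huvM]

/-- In a connector `C ∪ M` (cycle `c` spanning `V`, perfect matching `M`
on `S 0`, terminal sets `S 1, …, S k`), for every terminal set `S i` there is an
M-alternating path in the connector from a vertex of `S i` to a vertex of `S j` for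
some `j ≠ i`, whose endpoints are M-exposed. -/
theorem connector_alternating_path
    {V : Type*} [Fintype V] [DecidableEq V]
    (G : SimpleGraph V) (v₀ : V) (c : G.Walk v₀ v₀) (hc : c.IsCycle)
    (hspan : ∀ x : V, x ∈ c.support)
    (M : Finset (Sym2 V)) (hM : IsMatching G M)
    (hedges : ∀ e ∈ G.edgeSet, e ∈ c.edges ∨ e ∈ M)
    (k : ℕ) (hk : 2 ≤ k) (S : Fin (k + 1) → Set V)
    (hdisj : ∀ i j : Fin (k + 1), i ≠ j → Disjoint (S i) (S j))
    (hcover : ∀ x : V, ∃ i : Fin (k + 1), x ∈ S i)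
    (hterm : ∀ i : Fin (k + 1), i ≠ 0 → (S i).Nonempty)
    (hperf : ∀ x ∈ S 0, ∃ e ∈ M, x ∈ e)
    (hM0 : ∀ e ∈ M, ∀ x : V, x ∈ e → x ∈ S 0) :
    ∀ i : Fin (k + 1), i ≠ 0 →
      ∃ (j : Fin (k + 1)) (a b : V) (p : G.Walk a b),
        j ≠ 0 ∧ j ≠ i ∧ a ∈ S i ∧ b ∈ S j ∧ p.IsPath ∧ AltList M p.edges ∧
        MExposed M a ∧ MExposed M b := by
  classical
  intro i hi
  obtain ⟨a₀, ha₀⟩ := hterm i hi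
  obtain ⟨j, hj0, hji⟩ : ∃ j : Fin (k + 1), j ≠ 0 ∧ j ≠ i := by
    by_contra! h
    have hsub : (Finset.univ : Finset (Fin (k + 1))) ⊆ {0, i} := by
      intro j _
      by_cases hj : j = 0
      · simp [hj]
      · simp [h j hj]
    have := (Finset.card_le_card hsub).trans Finset.card_le_two
    simp at this
    omega
  obtain ⟨b₀, hb₀⟩ := hterm j hj0
  have huniq : ∀ {x : V} {i j : Fin (k + 1)}, x ∈ S i → x ∈ S j → i = j := by
    intro x i j hxi hxj
    by_contra h
    exact Set.disjoint_left.1 (hdisj i j h) hxi hxj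
  have ha0 : a₀ ∉ S 0 := fun h => hi (huniq ha₀ h)
  have hb0 : b₀ ∉ S 0 := fun h => hj0 (huniq hb₀ h)
  have hbi : b₀ ∉ S i := fun h => hji (huniq hb₀ h)
  have hab : a₀ ≠ b₀ := fun h => hbi (h ▸ ha₀)
  let W := {x : V // x ∈ S 0 ∨ x = a₀ ∨ x = b₀}
  let A : W := ⟨a₀, .inr (.inl rfl)⟩
  let B : W := ⟨b₀, .inr (.inr rfl)⟩
  have hAB : A ≠ B := fun h => hab (congrArg Subtype.val h)
  let π : V → W := fun x => if h : x ∈ S 0 then ⟨x, .inl h⟩ else if x ∈ S i then A else B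
  have hπS : ∀ x (h : x ∈ S 0), π x = ⟨x, .inl h⟩ := fun x h => dif_pos h
  have hπA : ∀ x, x ∈ S i → π x = A := by
    intro x hx
    have : x ∉ S 0 := fun h => hi (huniq hx h)
    simp [π, this, hx]
  have hπB : ∀ x, x ∉ S 0 → x ∉ S i → π x = B := by
    intro x hx hx'
    simp [π, hx, hx']
  have hneA : ∀ x, x ∈ S 0 → π x ≠ A := by
    intro x hx h
    rw [hπS x hx] at h
    obtain rfl : x = a₀ := congrArg Subtype.val h
    exact ha0 hx
  have hneB : ∀ x, x ∈ S 0 → π x ≠ B := by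
    intro x hx h
    rw [hπS x hx] at h
    obtain rfl : x = b₀ := congrArg Subtype.val h
    exact hb0 hx
  have hπmem : ∀ x, π x ≠ A → π x ≠ B → x ∈ S 0 := by
    intro x hxA hxB
    by_contra h
    by_cases hx : x ∈ S i
    · exact hxA (hπA x hx)
    · exact hxB (hπB x h hx)
  have hπinj : ∀ x y, π x = π y → π x ≠ A → π x ≠ B → x = y := by
    intro x y hxy hxA hxB
    have hx := hπmem x hxA hxB
    have hy := hπmem y (hxy ▸ hxA) (hxy ▸ hxB)
    rw [hπS x hx, hπS y hy] at hxy
    exact congrArg Subtype.val hxy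
  have hsurj : Function.Surjective π := by
    rintro ⟨x, hx | rfl | rfl⟩
    · exact ⟨x, hπS x hx⟩
    · exact ⟨x, hπA x ha₀⟩
    · exact ⟨x, hπB x hb0 hbi⟩
  have hMG : ∀ u v, s(u, v) ∈ M → G.Adj u v := fun u v h => hM.1 h
  have hM0' : ∀ u v, s(u, v) ∈ M → u ∈ S 0 ∧ v ∈ S 0 := fun u v h =>
    ⟨hM0 _ h u (Sym2.mem_mk_left u v), hM0 _ h v (Sym2.mem_mk_right u v)⟩
  have hMuniq : ∀ u v w, s(u, v) ∈ M → s(u, w) ∈ M → v = w := by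
    intro u v w hv hw
    by_contra h
    exact hM.2 _ hv _ hw (fun h' => h (Sym2.congr_right.1 h')) u
      (Sym2.mem_mk_left u v) (Sym2.mem_mk_left u w)
  let R : W → W → Prop := fun x y =>
    (x = A ∧ y = B) ∨ (x = B ∧ y = A) ∨ s(x.1, y.1) ∈ M
  have hRsymm : ∀ x y, R x y → R y x := by
    rintro x y (h | h | h)
    · exact .inr (.inl h.symm)
    · exact .inl h.symm
    · exact .inr (.inr (by rwa [Sym2.eq_swap]))
  have hRM : ∀ x y : W, s(x.1, y.1) ∈ M → x ≠ A ∧ x ≠ B := by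
    intro x y h
    refine ⟨?_, ?_⟩
    · rintro rfl
      exact ha0 (hM0' _ _ h).1
    · rintro rfl
      exact hb0 (hM0' _ _ h).1
  have hRuniq : ∀ x y z, R x y → R x z → y = z := by
    rintro x y z (h | h | h) (h' | h' | h')
    · rw [h.2, h'.2]
    · exact absurd (h.1.symm.trans h'.1) hAB
    · exact absurd h.1 (hRM _ _ h').1
    · exact absurd (h'.1.symm.trans h.1) hAB
    · rw [h.2, h'.2]
    · exact absurd h.1 (hRM _ _ h').2
    · exact absurd h'.1 (hRM _ _ h).1
    · exact absurd h'.1 (hRM _ _ h).2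
    · exact Subtype.ext (hMuniq _ _ _ h h')
  have hRex : ∀ x, ∃ y, R x y := by
    rintro ⟨x, hx | rfl | rfl⟩
    · obtain ⟨e, he, hxe⟩ := hperf x hx
      obtain ⟨y, rfl⟩ := hxe
      exact ⟨⟨y, .inl (hM0' _ _ he).2⟩, .inr (.inr he)⟩
    · exact ⟨B, .inl ⟨rfl, rfl⟩⟩
    · exact ⟨A, .inr (.inl ⟨rfl, rfl⟩)⟩
  choose m hmR using hRex
  have hm : Function.Involutive m := fun x => hRuniq _ _ _ (hmR (m x)) (hRsymm _ _ (hmR x))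
  have hmfix : ∀ x, m x ≠ x := by
    intro x hx
    rcases hmR x with h | h | h
    · exact hAB (h.1.symm.trans (hx.symm.trans h.2))
    · exact hAB (h.2.symm.trans (hx.trans h.1))
    · rw [hx] at h
      exact (hMG _ _ h).ne rfl
  have hmA : m A = B := hRuniq _ _ _ (hmR A) (.inl ⟨rfl, rfl⟩)
  have hmM' : ∀ x, x ≠ A → x ≠ B → s(x.1, (m x).1) ∈ M := by
    intro x hxA hxB
    rcases hmR x with h | h | h
    · exact absurd h.1 hxA
    · exact absurd h.1 hxB
    · exact h
  have hmM : ∀ x, x ≠ A → x ≠ B → ∃ u v, π u = x ∧ π v = m x ∧ s(u, v) ∈ M := by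
    intro x hxA hxB
    have h := hmM' x hxA hxB
    exact ⟨_, _, hπS _ (hM0' _ _ h).1, hπS _ (hM0' _ _ h).2, h⟩
  have hMm : ∀ u v, s(u, v) ∈ M → π u ≠ A ∧ π u ≠ B ∧ m (π u) = π v := by
    intro u v h
    obtain ⟨hu, hv⟩ := hM0' _ _ h
    refine ⟨hneA u hu, hneB u hu, hRuniq _ _ _ (hmR _) (.inr (.inr ?_))⟩
    rwa [hπS u hu, hπS v hv]
  let H : SimpleGraph W :=
    { Adj := fun x y => x ≠ y ∧ ∃ u v, π u = x ∧ π v = y ∧ G.Adj u v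
      symm := ⟨fun _ _ ⟨hne, u, v, hu, hv, h⟩ => ⟨hne.symm, v, u, hv, hu, h.symm⟩⟩
      loopless := ⟨fun _ h => h.1 rfl⟩ }
  obtain ⟨f, hinj, hfadj, hcyc⟩ := exists_cyclic_succ hc hspan
  obtain ⟨N, hN⟩ := exists_isPerfectMatching_of_cyclic_succ H hinj hcyc hsurj hπinj
    (fun x hx => ⟨hx, x, f x, rfl, rfl, hfadj x⟩) hm hmfix hmA (fun x hxA hxB => by
      obtain ⟨u, v, hu, hv, h⟩ := hmM x hxA hxB
      exact ⟨(hmfix x).symm, u, v, hu, hv, hMG _ _ h⟩)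
  rw [SimpleGraph.Subgraph.isPerfectMatching_iff] at hN
  choose n hnN hnuniq using hN
  have hn : Function.Involutive n := fun x => (hnuniq (n x) x (hnN x).symm).symm
  obtain ⟨u, w, p, hu, hw, hp, -, halt, -⟩ := exists_alternating_path_of_involutions
    hπinj hMG hm hmfix hMm hmM hn (fun x => (hnN x).adj_sub.ne')
    (fun x => (hnN x).adj_sub.2) Finset.univ A (Finset.mem_univ _) hAB (Finset.mem_univ _)
    (by simp) (fun _ _ => Finset.mem_univ _) (fun x _ _ hxB => ⟨Finset.mem_univ _, fun h => hxB (by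
      rw [← hm x, h, hmA])⟩)
  have hu0 : u ∉ S 0 := fun h => hneA u h hu
  have hw0 : w ∉ S 0 := fun h => hneB w h hw
  have hui : u ∈ S i := by
    by_contra h
    exact hAB (hu.symm.trans (hπB u hu0 h))
  have hwi : w ∉ S i := fun h => hAB ((hπA w h).symm.trans hw)
  obtain ⟨l, hl⟩ := hcover w
  exact ⟨l, u, w, p, fun h => hw0 (h ▸ hl), fun h => hwi (h ▸ hl), hui, hl, hp, halt,
    fun e he hue => hu0 (hM0 e he u hue), fun e he hwe => hw0 (hM0 e he w hwe)⟩

end Stabilizer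
end

section
/- Let x̂ be a basic maximum-weight fractional matching and y a minimum fractional w-vertex cover in a weighted graph G. If |𝒞(x̂)| > γ(G), then at least one of the following exists: (i) a vertex v ∈ V(C_i) for some odd cycle C_i ∈ 𝒞(x̂) with y_v = 0; or (ii) a tight M(x̂)-alternating path P connecting two distinct odd cycles C_i, C_j ∈ 𝒞(x̂); or (iii) a tight and valid M(x̂)-alternating path P connecting an odd cycle C_i ∈ 𝒞(x̂) to a vertex v not in V(𝒞(x̂)) with y_v = 0. -/
namespace Stabilizer

variable {V : Type*} [Fintype V] [DecidableEq V]

variable {G : SimpleGraph V}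

set_option linter.unusedSectionVars false

/-- The sum of `Y` over the two ends of an edge. -/
def endSum (Y : V → ℝ) : Sym2 V → ℝ :=
  Sym2.lift ⟨fun a b => Y a + Y b, fun a b => add_comm (Y a) (Y b)⟩

theorem sum_sum_sym2 (g : Sym2 V → ℝ) (hg : ∀ a, g s(a, a) = 0) :
    ∑ v, ∑ u, g s(v, u) = 2 * ∑ e, g e := by
  rw [← Fintype.sum_prod_type', Finset.mul_sum,
    ← Finset.sum_fiberwise (s := Finset.univ) (g := fun p : V × V => s(p.1, p.2))]
  refine Finset.sum_congr rfl fun e _ => ?_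
  induction e with | _ a b => ?_
  rw [Finset.sum_congr rfl (g := fun _ => g s(a, b)) (by
    intro p hp; rw [(Finset.mem_filter.1 hp).2])]
  by_cases hab : a = b
  · subst hab; simp [hg]
  · have : (Finset.univ.filter fun p : V × V => s(p.1, p.2) = s(a, b)) = {(a, b), (b, a)} := by
      ext ⟨p, q⟩; simp
    rw [this, Finset.sum_pair (by simp [hab])]; ring

theorem sum_mul_degree (Y : V → ℝ) (x : Sym2 V → ℝ) (hx : ∀ a, x s(a, a) = 0) :
    ∑ v, Y v * ∑ u, x s(v, u) = ∑ e, endSum Y e * x e := by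
  have h1 := sum_sum_sym2 (fun e => endSum Y e * x e) (by simp [hx])
  have h2 : ∑ v, ∑ u, Y u * x s(v, u) = ∑ v, ∑ u, Y v * x s(v, u) := by
    rw [Finset.sum_comm]; simp_rw [Sym2.eq_swap]
  simp only [endSum, Sym2.lift_mk, add_mul, Finset.sum_add_distrib] at h1
  rw [h2] at h1
  simp_rw [Finset.mul_sum]
  change _ = 2 * ∑ e, endSum Y e * x e at h1
  linarith

theorem nonpos_of_forall_add_mul_lt {c k u : ℝ} (h : ∀ t : ℝ, 0 ≤ t → c + t * k < u) : k ≤ 0 := by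
  by_contra! hk
  have := h (|u - c| / k) (by positivity)
  rw [div_mul_cancel₀ _ hk.ne'] at this
  linarith [le_abs_self (u - c)]

/-- Strong duality: some fractional cover has value at most the maximum weight of a
fractional matching. -/
theorem exists_cover_le (G : SimpleGraph V) (w x : Sym2 V → ℝ) (hx : IsMaxFracMatching G w x) :
    ∃ z, IsFracCover G w z ∧ coverValue z ≤ fracWeight w x := by
  set ν := fracWeight w x with hν
  let O : Set (ℝ × (V → ℝ)) := Set.Ioi ν ×ˢ Set.univ.pi fun _ => Set.Iio 0
  let A : Set (ℝ × (V → ℝ)) := {p | ∃ z : Sym2 V → ℝ, (∀ e, 0 ≤ z e) ∧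
    (∀ e, e ∉ G.edgeSet → z e = 0) ∧ p.1 = fracWeight w z ∧ ∀ v, p.2 v = (∑ u, z s(v, u)) - 1}
  have hOc : Convex ℝ O := (convex_Ioi ν).prod (convex_pi fun _ _ => convex_Iio 0)
  have hOo : IsOpen O := isOpen_Ioi.prod (isOpen_set_pi Set.finite_univ fun _ _ => isOpen_Iio)
  have hAc : Convex ℝ A := by
    rintro p ⟨z, hz0, hzG, hp1, hp2⟩ q ⟨z', hz0', hzG', hq1, hq2⟩ s t hs ht hst
    refine ⟨fun e => s * z e + t * z' e, fun e => ?_, fun e he => ?_, ?_, fun v => ?_⟩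
    · have := hz0 e; have := hz0' e; positivity
    · simp [hzG e he, hzG' e he]
    · simp only [Prod.fst_add, Prod.smul_fst, smul_eq_mul, hp1, hq1, fracWeight, Finset.mul_sum,
        ← Finset.sum_add_distrib]
      exact Finset.sum_congr rfl fun e _ => by ring
    · simp only [Prod.snd_add, Prod.smul_snd, smul_eq_mul, Pi.add_apply, Pi.smul_apply, hp2, hq2,
        Finset.sum_add_distrib, ← Finset.mul_sum]
      linear_combination -hst
  have hdisj : Disjoint O A := by
    rw [Set.disjoint_left]
    rintro p ⟨hp1, hp2⟩ ⟨z, hz0, hzG, hw, hs⟩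
    have := hx.2 z ⟨hz0, hzG, fun v => by
      have := hp2 v trivial
      rw [Set.mem_Iio, hs v] at this; linarith⟩
    rw [← hw] at this
    exact absurd hp1 (not_lt.2 this)
  obtain ⟨f, u, hfO, hfA⟩ := geometric_hahn_banach_open hOc hOo hAc hdisj
  set k := f (1, 0) with hk
  set Y : V → ℝ := fun v => f (0, Pi.single v 1) with hY
  have hf : ∀ r s, f (r, s) = k * r + ∑ v, Y v * s v := by
    intro r s
    have h1 : ((r, s) : ℝ × (V → ℝ)) =
        r • ((1, 0) : ℝ × (V → ℝ)) + ∑ v, s v • ((0, Pi.single v 1) : ℝ × (V → ℝ)) := by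
      refine Prod.ext ?_ ?_
      · simp [Prod.fst_sum]
      · ext j
        simp [Prod.snd_sum, Finset.sum_apply, Pi.single_apply]
    rw [h1, map_add, map_sum, map_smul]
    simp only [map_smul, smul_eq_mul, hk, hY]
    rw [mul_comm]
    congr 1
    exact Finset.sum_congr rfl fun v _ => mul_comm _ _
  have hO : ∀ (r : ℝ) (s : V → ℝ), ν < r → (∀ v, s v < 0) → k * r + ∑ v, Y v * s v < u := by
    intro r s hr hs
    rw [← hf]
    exact hfO _ ⟨hr, fun v _ => hs v⟩
  have hA : ∀ z : Sym2 V → ℝ, (∀ e, 0 ≤ z e) → (∀ e, e ∉ G.edgeSet → z e = 0) →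
      u ≤ k * fracWeight w z + ∑ e, endSum Y e * z e - ∑ v, Y v := by
    intro z hz0 hzG
    have := hfA (fracWeight w z, fun v => (∑ u, z s(v, u)) - 1) ⟨z, hz0, hzG, rfl, fun _ => rfl⟩
    rw [hf] at this
    rw [← sum_mul_degree Y z fun a => hzG _ (by simp)]
    simp only [mul_sub, mul_one, Finset.sum_sub_distrib] at this
    linarith
  have hk0 : k ≤ 0 := nonpos_of_forall_add_mul_lt
    (c := k * (ν + 1) + ∑ v, Y v * (-1)) (u := u) fun t ht => by
      have := hO (ν + 1 + t) (fun _ => -1) (by linarith) (by simp)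
      linarith
  have hY0 : ∀ v, 0 ≤ Y v := by
    intro v
    have : -Y v ≤ 0 := nonpos_of_forall_add_mul_lt
      (c := k * (ν + 1) + ∑ v, Y v * (-1)) (u := u) fun t ht => by
        have := hO (ν + 1) (fun j => -1 - t * (Pi.single v 1 : V → ℝ) j) (by linarith) (by
          intro j
          have : 0 ≤ (Pi.single v 1 : V → ℝ) j := by
            rw [Pi.single_apply]; split_ifs <;> norm_num
          nlinarith)
        have h2 : ∑ j, Y j * (-1 - t * (Pi.single v 1 : V → ℝ) j)
            = ∑ j, Y j * (-1) + t * (-Y v) := by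
          simp only [mul_sub, Finset.sum_sub_distrib, Pi.single_apply]
          simp
          ring
        linarith
    linarith
  have hu : k * ν ≤ u := by
    have hS : 0 ≤ ∑ v, Y v := Finset.sum_nonneg fun v _ => hY0 v
    refine le_of_forall_pos_lt_add fun ε hε => ?_
    set δ := ε / (1 - k + ∑ v, Y v) with hδ
    have hpos : 0 < 1 - k + ∑ v, Y v := by linarith
    have hδ0 : 0 < δ := by positivity
    have h1 := hO (ν + δ) (fun _ => -δ) (by linarith) (fun _ => by linarith)
    rw [← Finset.sum_mul] at h1
    have h2 : δ * (1 - k + ∑ v, Y v) = ε := div_mul_cancel₀ _ hpos.ne'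
    nlinarith
  have hu' : u ≤ -∑ v, Y v := by
    have := hA 0 (by simp) (by simp)
    simpa [fracWeight] using this
  have hk1 : k < 0 := by
    refine lt_of_le_of_ne hk0 fun h0 => ?_
    rw [h0] at hu
    have hS : ∑ v, Y v = 0 :=
      le_antisymm (by linarith) (Finset.sum_nonneg fun v _ => hY0 v)
    have := hO (ν + 1) (fun _ => -1) (by linarith) (by simp)
    rw [← Finset.sum_mul, hS, h0] at this
    linarith
  refine ⟨fun v => Y v / (-k), ⟨fun v => div_nonneg (hY0 v) (by linarith), fun a b hab => ?_⟩, ?_⟩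
  · have h := nonpos_of_forall_add_mul_lt (c := 0) (k := -(k * w s(a, b) + (Y a + Y b)))
      (u := 1 - u - ∑ v, Y v) fun t ht => by
        have := hA (Pi.single s(a, b) t) (fun e => by
          rw [Pi.single_apply]; split_ifs <;> simp [ht]) (fun e he => by
          rw [Pi.single_apply, if_neg]; rintro rfl; exact he hab)
        simp only [fracWeight, Pi.single_apply, mul_ite, mul_zero, Finset.sum_ite_eq',
          Finset.mem_univ, if_true, endSum, Sym2.lift_mk] at this
        linarith
    rw [← add_div, le_div_iff₀ (by linarith)]
    linarith
  · rw [coverValue, ← Finset.sum_div, div_le_iff₀ (by linarith)]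
    linarith

/-- Complementary slackness. -/
theorem complementary_slackness {G : SimpleGraph V} {w x : Sym2 V → ℝ} {y : V → ℝ}
    (hx : IsMaxFracMatching G w x) (hy : IsMinFracCover G w y) :
    (∀ a b, x s(a, b) ≠ 0 → y a + y b = w s(a, b)) ∧
    ∀ v, y v ≠ 0 → ∑ u, x s(v, u) = 1 := by
  obtain ⟨z, hz, hzx⟩ := exists_cover_le G w x hx
  have hle : coverValue y ≤ fracWeight w x := (hy.2 z hz).trans hzx
  obtain ⟨⟨hx0, hxG, hx1⟩, -⟩ := hx
  have hdeg := sum_mul_degree y x fun a => hxG _ (by simp)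
  have h1 : ∀ v ∈ Finset.univ, 0 ≤ y v * (1 - ∑ u, x s(v, u)) := fun v _ =>
    mul_nonneg (hy.1.1 v) (by linarith [hx1 v])
  have h2 : ∀ e ∈ Finset.univ, 0 ≤ (endSum y e - w e) * x e := by
    intro e _
    by_cases he : e ∈ G.edgeSet
    · refine mul_nonneg ?_ (hx0 e)
      induction e with | _ a b => ?_
      simpa [endSum] using hy.1.2 a b he
    · simp [hxG e he]
  have h3 : ∑ v, y v * (1 - ∑ u, x s(v, u)) + ∑ e, (endSum y e - w e) * x e ≤ 0 := by
    simp only [mul_sub, sub_mul, Finset.sum_sub_distrib, mul_one]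
    rw [coverValue, fracWeight] at hle
    linarith
  have h4 := Finset.sum_nonneg h1
  have h5 := Finset.sum_nonneg h2
  have h6 := (Finset.sum_eq_zero_iff_of_nonneg h1).1 (by linarith)
  have h7 := (Finset.sum_eq_zero_iff_of_nonneg h2).1 (by linarith)
  refine ⟨fun a b hab => ?_, fun v hv => ?_⟩
  · have := (mul_eq_zero.1 (h7 s(a, b) (Finset.mem_univ _))).resolve_right hab
    simp only [endSum, Sym2.lift_mk] at this
    linarith
  · have := (mul_eq_zero.1 (h6 v (Finset.mem_univ _))).resolve_left hv
    linarith

theorem IsMatching.eq_of_mem {G : SimpleGraph V} {M : Finset (Sym2 V)} (hM : IsMatching G M)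
    {e f : Sym2 V} (he : e ∈ M) (hf : f ∈ M) {v : V} (hve : v ∈ e) (hvf : v ∈ f) : e = f := by
  by_contra h
  exact hM.2 e he f hf h v hve hvf

theorem IsMatching.even_card {G : SimpleGraph V} {M : Finset (Sym2 V)} (hM : IsMatching G M)
    {S : Finset V} (hcov : ∀ v ∈ S, ∃ u, s(v, u) ∈ M)
    (hclosed : ∀ v ∈ S, ∀ u, s(v, u) ∈ M → u ∈ S) : Even S.card := by
  choose! g hg using hcov
  have hmem : ∀ v ∈ S, g v ∈ S := fun v hv => hclosed v hv _ (hg v hv)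
  have h : ∑ _v ∈ S, (1 : ZMod 2) = 0 := by
    refine Finset.sum_involution (fun v _ => g v) (fun _ _ => by decide) (fun v hv _ heq => ?_)
      hmem fun v hv => ?_
    · have := hM.1 (hg v hv)
      rw [heq] at this
      simp at this
    · have h1 := hM.eq_of_mem (hg v hv) (hg _ (hmem v hv)) (v := g v) (by simp) (by simp)
      rw [Sym2.eq_swap] at h1
      exact (Sym2.congr_right.1 h1).symm
  rw [Finset.sum_const, nsmul_one] at h
  exact (ZMod.natCast_eq_zero_iff_even).1 h

theorem altList_edges_of_isPath {G H : SimpleGraph V} {M N : Finset (Sym2 V)}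
    (hM : IsMatching G M) (hN : IsMatching G N) {a b : V} (p : H.Walk a b) (hp : p.IsPath)
    (hMN : ∀ e ∈ p.edges, e ∈ M ∨ e ∈ N) : AltList M p.edges := by
  change List.IsChain _ _
  induction p with
  | nil => simp
  | @cons u v c h q ih =>
    have hq := ih hp.of_cons fun e he => hMN e (by simp [he])
    cases q with
    | nil => simp
    | @cons _ z _ h' q =>
      rw [SimpleGraph.Walk.edges_cons, SimpleGraph.Walk.edges_cons, List.isChain_cons_cons]
      refine ⟨?_, hq⟩
      have hne : s(u, v) ≠ s(v, z) := by
        intro heq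
        rw [Sym2.eq_swap] at heq
        have huz := Sym2.congr_right.1 heq
        have := (SimpleGraph.Walk.cons_isPath_iff _ _).1 hp
        exact this.2 (by simp [huz])
      have h1 := hMN s(u, v) (by simp)
      have h2 := hMN s(v, z) (by simp)
      constructor
      · exact fun he hf => hne (hM.eq_of_mem he hf (v := v) (by simp) (by simp))
      · intro hf
        by_contra he
        exact hne (hN.eq_of_mem (h1.resolve_left he) (h2.resolve_left hf) (v := v)
          (by simp) (by simp))

theorem exists_getLast_edges {G : SimpleGraph V} {a b : V} (p : G.Walk a b) (hab : a ≠ b) :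
    ∃ e ∈ p.edges, b ∈ e ∧ p.edges.getLast? = some e := by
  obtain ⟨q, rfl⟩ : ∃ q : G.Walk b a, p = q.reverse := ⟨p.reverse, by simp⟩
  cases q with
  | nil => exact absurd rfl hab
  | @cons _ v _ h q => exact ⟨s(b, v), by simp, by simp, by simp⟩

/-- The alternating-path parity argument: a matching `N` missing only few vertices of positive
cover value must yield one of the three structures. -/
theorem exists_structure_of_matchings {G : SimpleGraph V} {w : Sym2 V → ℝ} {y : V → ℝ}
    {M N : Finset (Sym2 V)} (hM : IsMatching G M) (hN : IsMatching G N)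
    {F : Finset (Finset (Sym2 V))} {U : Finset V}
    (hodd : ∀ C ∈ F, ∃ S : Finset V, ↑S = edgeVerts C ∧ Odd S.card)
    (hexp : ∀ C ∈ F, ∀ v ∈ edgeVerts C, MExposed M v)
    (htight : ∀ a b, s(a, b) ∈ M ∨ s(a, b) ∈ N → y a + y b = w s(a, b))
    (hcovM : ∀ v, y v ≠ 0 → (∀ C ∈ F, v ∉ edgeVerts C) → ∃ u, s(v, u) ∈ M)
    (hcovN : ∀ v, y v ≠ 0 → v ∉ U → ∃ u, s(v, u) ∈ N)
    (hcard : U.card < F.card) :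
    (∃ C ∈ F, ∃ v ∈ edgeVerts C, y v = 0) ∨
    (∃ C ∈ F, ∃ D ∈ F, C ≠ D ∧
      ∃ (a b : V) (p : G.Walk a b),
        a ∈ edgeVerts C ∧ b ∈ edgeVerts D ∧ p.IsPath ∧
        AltList M p.edges ∧ IsTightWalk w y p) ∨
    (∃ C ∈ F, ∃ (a v : V) (p : G.Walk a v),
      a ∈ edgeVerts C ∧ (∀ D ∈ F, v ∉ edgeVerts D) ∧ y v = 0 ∧ p.IsPath ∧
      AltList M p.edges ∧ IsValidWalk M p ∧ IsTightWalk w y p) := by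
  classical
  by_contra! hcon
  obtain ⟨hi, hii, hiii⟩ := hcon
  let H : SimpleGraph V := SimpleGraph.fromEdgeSet (↑M ∪ ↑N)
  have hHG : H ≤ G := by
    intro a b hab
    rcases ((SimpleGraph.fromEdgeSet_adj _).1 hab).1 with h | h
    · exact hM.1 h
    · exact hN.1 h
  have hadj : ∀ {a b}, s(a, b) ∈ M ∨ s(a, b) ∈ N → H.Adj a b := by
    intro a b hab
    have hG : s(a, b) ∈ G.edgeSet := hab.elim (fun h => hM.1 h) (fun h => hN.1 h)
    exact (SimpleGraph.fromEdgeSet_adj _).2 ⟨hab, SimpleGraph.Adj.ne hG⟩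
  have hpath : ∀ {a b}, H.Reachable a b → ∃ p : G.Walk a b, p.IsPath ∧ AltList M p.edges ∧
      IsTightWalk w y p ∧ ∀ e ∈ p.edges, e ∈ M ∨ e ∈ N := by
    intro a b hab
    obtain ⟨p, hp⟩ := hab.exists_isPath
    have hMN : ∀ e ∈ p.edges, e ∈ M ∨ e ∈ N := by
      intro e he
      have := p.edges_subset_edgeSet he
      rw [SimpleGraph.edgeSet_fromEdgeSet] at this
      exact this.1
    have hMN' : ∀ e ∈ (p.mapLe hHG).edges, e ∈ M ∨ e ∈ N := by
      rwa [SimpleGraph.Walk.edges_mapLe_eq_edges]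
    exact ⟨p.mapLe hHG, hp.mapLe hHG, altList_edges_of_isPath hM hN _ (hp.mapLe hHG) hMN',
      fun d hd => htight _ _ (hMN' _ (List.mem_map_of_mem hd)), hMN'⟩
  have hsame : ∀ C ∈ F, ∀ D ∈ F, ∀ a ∈ edgeVerts C, ∀ b ∈ edgeVerts D, H.Reachable a b →
      C = D := by
    intro C hC D hD a ha b hb hab
    by_contra hne
    obtain ⟨p, hp, halt, ht, -⟩ := hpath hab
    exact hii C hC D hD hne a b p ha hb hp halt ht
  have hU : ∀ C ∈ F, ∃ u ∈ U, ∃ a ∈ edgeVerts C, H.Reachable a u := by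
    intro C hC
    by_contra! hno
    obtain ⟨S, hS, hSodd⟩ := hodd C hC
    have hmemS : ∀ v, v ∈ S ↔ v ∈ edgeVerts C := fun v => by rw [← hS]; simp
    rw [← Nat.not_even_iff_odd] at hSodd
    apply hSodd
    rw [Finset.card_eq_sum_card_image H.connectedComponentMk S]
    refine Finset.even_sum _ fun K hK => ?_
    obtain ⟨a, haS, rfl⟩ := Finset.mem_image.1 hK
    have haC := (hmemS a).1 haS
    let T : Finset V := Finset.univ.filter fun v => H.Reachable a v
    have hT : ∀ v, v ∈ T ↔ H.Reachable a v := fun v => by simp [T]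
    have hNcov : ∀ v ∈ T, ∃ u, s(v, u) ∈ N := by
      intro v hv
      rw [hT] at hv
      by_cases hy : y v = 0
      · by_contra hvN
        have hvF : ∀ D ∈ F, v ∉ edgeVerts D := fun D hD hvD => hi D hD v hvD hy
        obtain ⟨p, hp, halt, ht, hMN⟩ := hpath hv
        refine hiii C hC a v p haC hvF hy hp halt ⟨Or.inl (hexp C hC a haC), Or.inr ?_⟩ ht
        have hav : a ≠ v := by rintro rfl; exact hvF C hC haC
        obtain ⟨e, he, hve, hlast⟩ := exists_getLast_edges p hav
        refine ⟨e, (hMN e he).resolve_right fun heN => hvN ?_, hlast⟩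
        obtain ⟨u, rfl⟩ := hve
        exact ⟨u, heN⟩
      · exact hcovN v hy fun hvU => hno v hvU a haC hv
    have hMcov : ∀ v ∈ T \ S, ∃ u, s(v, u) ∈ M := by
      intro v hv
      obtain ⟨hv, hvS⟩ := Finset.mem_sdiff.1 hv
      rw [hT] at hv
      have hvF : ∀ D ∈ F, v ∉ edgeVerts D := by
        intro D hD hvD
        obtain rfl := hsame C hC D hD a haC v hvD hv
        exact hvS ((hmemS v).2 hvD)
      by_cases hy : y v = 0
      · by_contra hvM
        obtain ⟨p, hp, halt, ht, -⟩ := hpath hv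
        refine hiii C hC a v p haC hvF hy hp halt
          ⟨Or.inl (hexp C hC a haC), Or.inl fun e he hve => hvM ?_⟩ ht
        obtain ⟨u, rfl⟩ := hve
        exact ⟨u, he⟩
      · exact hcovM v hy hvF
    have hTeven : Even T.card := hN.even_card hNcov fun v hv u hu => by
      rw [hT] at hv ⊢
      exact hv.trans (hadj (Or.inr hu)).reachable
    have hTSeven : Even (T \ S).card := hM.even_card hMcov fun v hv u hu => by
      obtain ⟨hv, hvS⟩ := Finset.mem_sdiff.1 hv
      rw [hT] at hv
      rw [Finset.mem_sdiff, hT, hmemS]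
      exact ⟨hv.trans (hadj (Or.inl hu)).reachable, fun huC => hexp C hC u huC _ hu (by simp)⟩
    have heq : S.filter (fun v => H.connectedComponentMk v = H.connectedComponentMk a) = T ∩ S := by
      ext v
      rw [Finset.mem_filter, Finset.mem_inter, hT, SimpleGraph.ConnectedComponent.eq, and_comm,
        SimpleGraph.reachable_comm]
    rw [heq]
    rw [← Finset.card_inter_add_card_sdiff T S, Nat.even_add] at hTeven
    exact hTeven.2 hTSeven
  obtain ⟨C₀, hC₀⟩ := Finset.card_pos.1 (Nat.zero_lt_of_lt hcard)
  obtain ⟨u₀, -, -⟩ := hU C₀ hC₀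
  have : Nonempty V := ⟨u₀⟩
  choose! f hfU g hgC hgf using hU
  refine hcard.not_ge (Finset.card_le_card_of_injOn f (fun C hC => hfU C hC) ?_)
  intro C hC D hD hCD
  refine hsame C hC D hD (g C) (hgC C hC) (g D) (hgC D hD) ((hgf C hC).trans ?_)
  rw [hCD]
  exact (hgf D hD).symm

theorem IsOddCycleEdgeSet.exists_vertex_finset {G : SimpleGraph V} {C : Finset (Sym2 V)}
    (hC : IsOddCycleEdgeSet G C) :
    (∃ S : Finset V, ↑S = edgeVerts C ∧ Odd S.card) ∧
    ∃ (N : Finset (Sym2 V)) (u : V), N ⊆ C ∧ IsMatching G N ∧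
      ∀ z ∈ edgeVerts C, z ≠ u → ∃ v, s(z, v) ∈ N := by
  obtain ⟨v, c, hc, hodd, rfl⟩ := hC
  have hinj := hc.getVert_injOn
  have hverts : ∀ z, z ∈ edgeVerts c.edges.toFinset ↔
      ∃ i, 1 ≤ i ∧ i ≤ c.length ∧ c.getVert i = z := by
    intro z
    constructor
    · rintro ⟨e, he, hz⟩
      obtain ⟨z', rfl⟩ := hz
      obtain ⟨i, hi, hil⟩ := SimpleGraph.Walk.mem_support_iff_exists_getVert.1
        (c.fst_mem_support_of_mem_edges (List.mem_toFinset.1 he))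
      rcases Nat.eq_zero_or_pos i with rfl | h0
      · exact ⟨c.length, hodd.pos, le_rfl, by rw [← hi]; simp⟩
      · exact ⟨i, h0, hil, hi⟩
    · rintro ⟨i, hi, hil, rfl⟩
      refine ⟨s(c.getVert (i - 1), c.getVert i), ?_, by simp⟩
      rw [List.mem_toFinset, c.mk_mem_edges_iff_exists]
      exact ⟨i - 1, by omega, by rw [Nat.sub_add_cancel hi]⟩
  refine ⟨⟨(Finset.Icc 1 c.length).image c.getVert, ?_, ?_⟩, ?_⟩
  · ext z
    rw [hverts]
    simp [and_assoc]
  · rw [Finset.card_image_of_injOn]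
    · simpa using hodd
    · intro i hi j hj hij
      exact hinj (by simpa using hi) (by simpa using hj) hij
  · obtain ⟨k, hk⟩ := hodd
    let E : ℕ → Sym2 V := fun i => s(c.getVert (2 * i + 1), c.getVert (2 * i + 2))
    have hE : ∀ i < k, E i ∈ c.edges := fun i hi =>
      c.mk_mem_edges_iff_exists.2 ⟨2 * i + 1, by omega, rfl⟩
    refine ⟨(Finset.range k).image E, c.getVert c.length, ?_, ⟨?_, ?_⟩, ?_⟩
    · intro e he
      obtain ⟨i, hi, rfl⟩ := Finset.mem_image.1 he
      exact List.mem_toFinset.2 (hE i (Finset.mem_range.1 hi))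
    · intro e he
      obtain ⟨i, hi, rfl⟩ := Finset.mem_image.1 he
      exact c.edges_subset_edgeSet (hE i (Finset.mem_range.1 hi))
    · intro e he f hf hne z hze hzf
      obtain ⟨i, hi, rfl⟩ := Finset.mem_image.1 he
      obtain ⟨j, hj, rfl⟩ := Finset.mem_image.1 hf
      rw [Finset.mem_range] at hi hj
      have key : ∀ m n, 1 ≤ m → m ≤ c.length → 1 ≤ n → n ≤ c.length →
          z = c.getVert m → z = c.getVert n → m = n := fun m n h1 h2 h3 h4 hm hn =>
        hinj ⟨h1, h2⟩ ⟨h3, h4⟩ (hm.symm.trans hn)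
      have hij : i = j := by
        rcases Sym2.mem_iff.1 hze with h | h <;> rcases Sym2.mem_iff.1 hzf with h' | h' <;>
        · have := key _ _ (by omega) (by omega) (by omega) (by omega) h h'
          omega
      exact hne (by rw [hij])
    · intro z hz hzu
      obtain ⟨i, hi, hil, rfl⟩ := (hverts z).1 hz
      have hilt : i < c.length := lt_of_le_of_ne hil fun h => hzu (by rw [h])
      obtain ⟨j, hj | hj⟩ := Nat.even_or_odd' i
      · refine ⟨c.getVert (2 * (j - 1) + 1), Finset.mem_image.2 ⟨j - 1, by simp; omega, ?_⟩⟩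
        rw [Sym2.eq_swap]
        simp only [E]
        rw [show 2 * (j - 1) + 2 = i by omega]
      · exact ⟨c.getVert (2 * j + 2), Finset.mem_image.2 ⟨j, by simp; omega, by rw [hj]⟩⟩

theorem IsFracMatching.add_le_one {G : SimpleGraph V} {x : Sym2 V → ℝ} (hx : IsFracMatching G x)
    {e f : Sym2 V} (hef : e ≠ f) {v : V} (he : v ∈ e) (hf : v ∈ f) : x e + x f ≤ 1 := by
  classical
  obtain ⟨a, rfl⟩ := he
  obtain ⟨b, rfl⟩ := hf
  have hab : a ≠ b := by rintro rfl; exact hef rfl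
  rw [← Finset.sum_pair (f := fun u => x s(v, u)) hab]
  exact (Finset.sum_le_sum_of_subset_of_nonneg (Finset.subset_univ _) fun _ _ _ => hx.1 _).trans
    (hx.2.2 v)

theorem mem_oneEdges {x : Sym2 V → ℝ} {e : Sym2 V} : e ∈ oneEdges x ↔ x e = 1 := by
  simp [oneEdges]

theorem isMatching_oneEdges {G : SimpleGraph V} {x : Sym2 V → ℝ} (hx : IsFracMatching G x) :
    IsMatching G (oneEdges x) := by
  refine ⟨fun e he => ?_, fun e he f hf hne v hve hvf => ?_⟩
  · by_contra h
    have := mem_oneEdges.1 he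
    rw [hx.2.1 e h] at this
    norm_num at this
  · have := hx.add_le_one hne hve hvf
    rw [mem_oneEdges.1 he, mem_oneEdges.1 hf] at this
    norm_num at this

theorem mExposed_oneEdges {G : SimpleGraph V} {x : Sym2 V → ℝ} (hx : IsFracMatching G x)
    {F : Finset (Finset (Sym2 V))} (hF : IsCycleFamily G x F) :
    ∀ C ∈ F, ∀ v ∈ edgeVerts C, MExposed (oneEdges x) v := by
  rintro C hC v ⟨f, hf, hvf⟩ e he hve
  have h1 := mem_oneEdges.1 he
  have h2 := (hF.2.2 f).2 ⟨C, hC, hf⟩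
  have hne : e ≠ f := by rintro rfl; rw [h1] at h2; norm_num at h2
  have := hx.add_le_one hne hve hvf
  rw [h1, h2] at this
  norm_num at this

theorem exists_oneEdge_or_mem_cycle {G : SimpleGraph V} {x : Sym2 V → ℝ} (hhalf : IsHalfIntegral x)
    {F : Finset (Finset (Sym2 V))} (hF : IsCycleFamily G x F) {v : V}
    (hv : ∑ u, x s(v, u) = 1) : (∃ u, s(v, u) ∈ oneEdges x) ∨ ∃ C ∈ F, v ∈ edgeVerts C := by
  obtain ⟨u, -, hu⟩ := Finset.exists_ne_zero_of_sum_ne_zero (by rw [hv]; exact one_ne_zero)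
  rcases hhalf s(v, u) with h | h | h
  · exact absurd h hu
  · obtain ⟨C, hC, he⟩ := (hF.2.2 _).1 h
    exact Or.inr ⟨C, hC, _, he, by simp⟩
  · exact Or.inl ⟨u, mem_oneEdges.2 h⟩

/-- Rounding every odd cycle of a basic fractional matching gives a matching inside its support
that misses at most one vertex per cycle. -/
theorem exists_rounded_matching {G : SimpleGraph V} {x : Sym2 V → ℝ} (hx : IsFracMatching G x)
    (hhalf : IsHalfIntegral x) {F : Finset (Finset (Sym2 V))} (hF : IsCycleFamily G x F) :
    ∃ (N : Finset (Sym2 V)) (U : Finset V), IsMatching G N ∧ U.card ≤ F.card ∧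
      (∀ e ∈ N, x e ≠ 0) ∧ ∀ v, ∑ u, x s(v, u) = 1 → v ∉ U → ∃ u, s(v, u) ∈ N := by
  rcases isEmpty_or_nonempty V with hV | hV
  · exact ⟨∅, ∅, ⟨by simp, by simp⟩, by simp, by simp, fun v => hV.elim v⟩
  have h := fun C hC => (hF.1 C hC).exists_vertex_finset.2
  choose! N u hNC hNM hcov using h
  refine ⟨oneEdges x ∪ F.biUnion N, F.image u, ⟨?_, ?_⟩, Finset.card_image_le, ?_, ?_⟩
  · intro e he
    rcases Finset.mem_union.1 he with he | he
    · exact (isMatching_oneEdges hx).1 he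
    · obtain ⟨C, hC, he⟩ := Finset.mem_biUnion.1 he
      exact (hNM C hC).1 he
  · intro e he f hf hne v hve hvf
    rcases Finset.mem_union.1 he with he | he <;> rcases Finset.mem_union.1 hf with hf | hf
    · exact (isMatching_oneEdges hx).2 e he f hf hne v hve hvf
    · obtain ⟨C, hC, hf⟩ := Finset.mem_biUnion.1 hf
      exact mExposed_oneEdges hx hF C hC v ⟨f, hNC C hC hf, hvf⟩ e he hve
    · obtain ⟨C, hC, he⟩ := Finset.mem_biUnion.1 he
      exact mExposed_oneEdges hx hF C hC v ⟨e, hNC C hC he, hve⟩ f hf hvf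
    · obtain ⟨C, hC, he⟩ := Finset.mem_biUnion.1 he
      obtain ⟨D, hD, hf⟩ := Finset.mem_biUnion.1 hf
      by_cases hCD : C = D
      · subst hCD
        exact (hNM C hC).2 e he f hf hne v hve hvf
      · exact Set.disjoint_left.1 (hF.2.1 C hC D hD hCD) ⟨e, hNC C hC he, hve⟩
          ⟨f, hNC D hD hf, hvf⟩
  · intro e he
    rcases Finset.mem_union.1 he with he | he
    · rw [mem_oneEdges.1 he]; exact one_ne_zero
    · obtain ⟨C, hC, he⟩ := Finset.mem_biUnion.1 he
      rw [(hF.2.2 e).2 ⟨C, hC, hNC C hC he⟩]; norm_num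
  · intro v hv hvU
    rcases exists_oneEdge_or_mem_cycle hhalf hF hv with ⟨z, hz⟩ | ⟨C, hC, hvC⟩
    · exact ⟨z, Finset.mem_union_left _ hz⟩
    · obtain ⟨z, hz⟩ := hcov C hC v hvC (by
        rintro rfl; exact hvU (Finset.mem_image_of_mem u hC))
      exact ⟨z, Finset.mem_union_right _ (Finset.mem_biUnion.2 ⟨C, hC, hz⟩)⟩

/-- if a basic maximum-weight fractional matching `x` has more than
γ(G) odd cycles, then one of the three structures of Theorem 3.4 exists. -/
theorem exists_reducing_structure
    {V : Type*} [Fintype V] [DecidableEq V]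
    (G : SimpleGraph V) (w : Sym2 V → ℝ) (hw : ∀ e, 0 ≤ w e)
    (x : Sym2 V → ℝ) (F : Finset (Finset (Sym2 V)))
    (hx : IsMaxFracMatching G w x) (hhalf : IsHalfIntegral x)
    (hF : IsCycleFamily G x F)
    (y : V → ℝ) (hy : IsMinFracCover G w y)
    (hcard : gamma G w < F.card) :
    (∃ C ∈ F, ∃ v ∈ edgeVerts C, y v = 0) ∨
    (∃ C ∈ F, ∃ D ∈ F, C ≠ D ∧
      ∃ (a b : V) (p : G.Walk a b),
        a ∈ edgeVerts C ∧ b ∈ edgeVerts D ∧ p.IsPath ∧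
        AltList (oneEdges x) p.edges ∧ IsTightWalk w y p) ∨
    (∃ C ∈ F, ∃ (a v : V) (p : G.Walk a v),
      a ∈ edgeVerts C ∧ (∀ D ∈ F, v ∉ edgeVerts D) ∧ y v = 0 ∧ p.IsPath ∧
      AltList (oneEdges x) p.edges ∧ IsValidWalk (oneEdges x) p ∧
      IsTightWalk w y p) := by
  obtain ⟨x', F', hx', hhalf', hF', hcard'⟩ : gamma G w ∈ {n : ℕ | ∃ (x : Sym2 V → ℝ)
      (F : Finset (Finset (Sym2 V))), IsMaxFracMatching G w x ∧ IsHalfIntegral x ∧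
      IsCycleFamily G x F ∧ F.card = n} :=
    Nat.sInf_mem ⟨F.card, x, F, hx, hhalf, hF, rfl⟩
  obtain ⟨htight, hsat⟩ := complementary_slackness hx hy
  obtain ⟨htight', hsat'⟩ := complementary_slackness hx' hy
  obtain ⟨N, U, hN, hU, hNx, hNcov⟩ := exists_rounded_matching hx'.1 hhalf' hF'
  refine exists_structure_of_matchings (isMatching_oneEdges hx.1) hN
    (fun C hC => (hF.1 C hC).exists_vertex_finset.1) (mExposed_oneEdges hx.1 hF) ?_ ?_
    (fun v hv => hNcov v (hsat' v hv)) (by omega)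
  · rintro a b (h | h)
    · exact htight a b (by rw [mem_oneEdges.1 h]; exact one_ne_zero)
    · exact htight' a b (hNx _ h)
  · intro v hv hvF
    rcases exists_oneEdge_or_mem_cycle hhalf hF (hsat v hv) with h | ⟨C, hC, hvC⟩
    · exact h
    · exact absurd hvC (hvF C hC)

end Stabilizer
end

section
/- Let x and x' be two basic fractional matchings of a graph G, and let H be the subgraph of G induced by the edge set supp(x+x') = {e ∈ E : x_e + x'_e ≠ 0}. Then for any connected component K of H, the vector obtained from x by switching on E(K) from x to x' (i.e., replacing x_e by x'_e for all edges e of K) is again a basic fractional matching of G. -/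
namespace Stabilizer

variable {V : Type*} [Fintype V] [DecidableEq V]

variable {G : SimpleGraph V}

/-- The vertices of an odd cycle all of whose edges lie in `H` are mutually reachable in `H`. -/
theorem IsOddCycleEdgeSet.reachable {V : Type*} [DecidableEq V] {G H : SimpleGraph V}
    {C : Finset (Sym2 V)} (hC : IsOddCycleEdgeSet G C) (hCH : ∀ e ∈ C, e ∈ H.edgeSet)
    {a b : V} (ha : a ∈ edgeVerts C) (hb : b ∈ edgeVerts C) : H.Reachable a b := by
  obtain ⟨v, c, -, -, rfl⟩ := hC
  have hc : ∀ e ∈ c.edges, e ∈ H.edgeSet := fun e he => hCH e (List.mem_toFinset.2 he)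
  have key : ∀ u ∈ edgeVerts c.edges.toFinset, H.Reachable v u := by
    rintro u ⟨e, he, hue⟩
    have hu : u ∈ (c.transfer H hc).support := by
      rw [SimpleGraph.Walk.support_transfer]
      exact SimpleGraph.Walk.mem_support_of_mem_edges (List.mem_toFinset.1 he) hue
    exact ⟨(c.transfer H hc).takeUntil u hu⟩
  exact (key a ha).symm.trans (key b hb)

/-- The vertices of a cycle of `𝒞(x)` lie in one component of any graph containing the
half-valued edges of `x`. -/
theorem IsCycleFamily.connectedComponentMk_eq {V : Type*} [DecidableEq V]
    {G H : SimpleGraph V} {x : Sym2 V → ℝ} {F : Finset (Finset (Sym2 V))}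
    (hF : IsCycleFamily G x F) (hH : ∀ e ∈ G.edgeSet, x e ≠ 0 → e ∈ H.edgeSet)
    {C : Finset (Sym2 V)} (hC : C ∈ F) {a b : V} (ha : a ∈ edgeVerts C)
    (hb : b ∈ edgeVerts C) : H.connectedComponentMk a = H.connectedComponentMk b := by
  refine SimpleGraph.ConnectedComponent.eq.2 ((hF.1 C hC).reachable (fun e he => ?_) ha hb)
  have hxe : x e = 1 / 2 := (hF.2.2 e).2 ⟨C, hC, he⟩
  refine hH e ?_ (by rw [hxe]; norm_num)
  obtain ⟨v, c, -, -, rfl⟩ := hF.1 C hC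
  exact c.edges_subset_edgeSet (List.mem_toFinset.1 he)

/-- switching between two basic fractional matchings on a connected
component of the subgraph induced by `supp(x + x')` yields a basic fractional
matching. -/
theorem switching_basic
    {V : Type*} [Fintype V] [DecidableEq V]
    (G : SimpleGraph V) (x x' : Sym2 V → ℝ)
    (hx : IsBasic G x) (hx' : IsBasic G x')
    (H : SimpleGraph V)
    (hH : H = SimpleGraph.fromEdgeSet {e : Sym2 V | x e + x' e ≠ 0})
    (K : H.ConnectedComponent) (z : Sym2 V → ℝ)
    (hz1 : ∀ e : Sym2 V, x e + x' e ≠ 0 →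
      (∀ a : V, a ∈ e → H.connectedComponentMk a = K) → z e = x' e)
    (hz2 : ∀ e : Sym2 V,
      (x e + x' e = 0 ∨ ∃ a : V, a ∈ e ∧ H.connectedComponentMk a ≠ K) → z e = x e) :
    IsBasic G z := by
  classical
  obtain ⟨⟨hx0, hxG, hx1⟩, hxh, F, hF⟩ := hx
  obtain ⟨⟨hx0', hxG', hx1'⟩, hxh', F', hF'⟩ := hx'
  have hEdge : ∀ e ∈ G.edgeSet, x e + x' e ≠ 0 → e ∈ H.edgeSet := by
    intro e he hne
    rw [hH, SimpleGraph.edgeSet_fromEdgeSet]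
    exact ⟨hne, G.not_isDiag_of_mem_edgeSet he⟩
  have hxH : ∀ e ∈ G.edgeSet, x e ≠ 0 → e ∈ H.edgeSet := fun e he h =>
    hEdge e he (add_pos_of_pos_of_nonneg ((hx0 e).lt_of_ne' h) (hx0' e)).ne'
  have hxH' : ∀ e ∈ G.edgeSet, x' e ≠ 0 → e ∈ H.edgeSet := fun e he h =>
    hEdge e he (add_pos_of_nonneg_of_pos (hx0 e) ((hx0' e).lt_of_ne' h)).ne'
  have hin : ∀ e : Sym2 V, ∀ a ∈ e, H.connectedComponentMk a = K → z e = x' e := by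
    intro e a hae ha
    by_cases h0 : x e + x' e = 0
    · rw [hz2 e (Or.inl h0)]
      linarith [hx0 e, hx0' e]
    · have heG : e ∈ G.edgeSet := by
        by_contra h
        exact h0 (by rw [hxG e h, hxG' e h, add_zero])
      have heH := hEdge e heG h0
      refine hz1 e h0 fun b hbe => ?_
      obtain ⟨c, rfl⟩ := Sym2.mem_iff_exists.1 hae
      obtain rfl | rfl := Sym2.mem_iff.1 hbe
      · exact ha
      · exact (SimpleGraph.ConnectedComponent.eq.2
          (SimpleGraph.Adj.reachable heH).symm).trans ha
  have hout : ∀ e : Sym2 V, ∀ a ∈ e, H.connectedComponentMk a ≠ K → z e = x e :=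
    fun e a hae ha => hz2 e (Or.inr ⟨a, hae, ha⟩)
  have hcases : ∀ e, z e = x e ∨ z e = x' e := by
    intro e
    have hae := e.out_fst_mem
    by_cases ha : H.connectedComponentMk (Quot.out e).1 = K
    · exact Or.inr (hin e _ hae ha)
    · exact Or.inl (hout e _ hae ha)
  refine ⟨⟨fun e => ?_, fun e he => ?_, fun v => ?_⟩, fun e => ?_,
    F.filter (fun C => ∀ v ∈ edgeVerts C, H.connectedComponentMk v ≠ K) ∪
      F'.filter (fun C => ∀ v ∈ edgeVerts C, H.connectedComponentMk v = K), ?_, ?_, fun e => ?_⟩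
  · obtain h | h := hcases e <;> rw [h]
    exacts [hx0 e, hx0' e]
  · obtain h | h := hcases e <;> rw [h]
    exacts [hxG e he, hxG' e he]
  · by_cases hv : H.connectedComponentMk v = K
    · rw [Finset.sum_congr rfl fun u _ => hin s(v, u) v (Sym2.mem_mk_left v u) hv]
      exact hx1' v
    · rw [Finset.sum_congr rfl fun u _ => hout s(v, u) v (Sym2.mem_mk_left v u) hv]
      exact hx1 v
  · obtain h | h := hcases e <;> rw [h]
    exacts [hxh e, hxh' e]
  · intro C hC
    obtain hC | hC := Finset.mem_union.1 hC
    exacts [hF.1 C (Finset.mem_filter.1 hC).1, hF'.1 C (Finset.mem_filter.1 hC).1]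
  · intro C hC D hD hCD
    rw [Finset.mem_union, Finset.mem_filter, Finset.mem_filter] at hC hD
    obtain ⟨hC, hCK⟩ | ⟨hC, hCK⟩ := hC <;> obtain ⟨hD, hDK⟩ | ⟨hD, hDK⟩ := hD
    · exact hF.2.1 C hC D hD hCD
    · exact Set.disjoint_left.2 fun v hvC hvD => hCK v hvC (hDK v hvD)
    · exact Set.disjoint_left.2 fun v hvC hvD => hDK v hvD (hCK v hvC)
    · exact hF'.2.1 C hC D hD hCD
  · simp only [Finset.mem_union, Finset.mem_filter]
    have hae := e.out_fst_mem
    set a := (Quot.out e).1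
    by_cases ha : H.connectedComponentMk a = K
    · rw [hin e a hae ha, hF'.2.2 e]
      constructor
      · rintro ⟨C, hC, heC⟩
        exact ⟨C, Or.inr ⟨hC, fun v hv =>
          (hF'.connectedComponentMk_eq hxH' hC hv ⟨e, heC, hae⟩).trans ha⟩, heC⟩
      · rintro ⟨C, ⟨_, hCK⟩ | ⟨hC, _⟩, heC⟩
        exacts [absurd ha (hCK a ⟨e, heC, hae⟩), ⟨C, hC, heC⟩]
    · rw [hout e a hae ha, hF.2.2 e]
      constructor
      · rintro ⟨C, hC, heC⟩
        exact ⟨C, Or.inl ⟨hC, fun v hv hvK =>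
          ha ((hF.connectedComponentMk_eq hxH hC ⟨e, heC, hae⟩ hv).trans hvK)⟩, heC⟩
      · rintro ⟨C, ⟨hC, _⟩ | ⟨_, hCK⟩, heC⟩
        exacts [⟨C, hC, heC⟩, absurd (hCK a ⟨e, heC, hae⟩) ha]

end Stabilizer
end
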